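/- Let Φ be an (N_x+1)×(N_y+1) real matrix with all entries positive, and let U, V : ℝ → M_{(N_x+1)×(N_y+1)}(ℝ) and R : ℝ → ℝ be differentiable. Suppose H₁(t) := (Φ·(𝟙 − cos U(t)), 𝟙)_Λ > 0 for all t, set b(t) := (H₁(t))^{−1/2} Φ·sin U(t), and suppose the SAV-reformulated SBP semi-discrete system holds: U' = V, V' = Δ̄_h U − R b, R' = ½(b, U')_Λ. Then the modified weighted semi-discrete energy H̃(t) = ½‖V(t)‖_Λ² + ½‖∇_h⁺U(t)‖_Λ² + R(t)² is constant in t. -/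

import Mathlib

open Matrix

noncomputable section

/-- Forward difference matrix `D⁺` on a grid with `M` points:
`(D⁺)_{j,j} = -1/h`, `(D⁺)_{j,j+1} = 1/h` for the first `M-1` rows, last row zero. -/
def Dplus (M : ℕ) (h : ℝ) : Matrix (Fin M) (Fin M) ℝ :=
  Matrix.of fun j k =>
    if (j : ℕ) + 1 < M then
      if k = j then -1 / h else if (k : ℕ) = (j : ℕ) + 1 then 1 / h else 0
    else 0

/-- Backward difference matrix `D⁻`: `(D⁻)_{j,j} = 1/h`, `(D⁻)_{j,j-1} = -1/h`
for all rows but the first, first row zero. -/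
def Dminus (M : ℕ) (h : ℝ) : Matrix (Fin M) (Fin M) ℝ :=
  Matrix.of fun j k =>
    if 1 ≤ (j : ℕ) then
      if k = j then 1 / h else if (k : ℕ) + 1 = (j : ℕ) then -1 / h else 0
    else 0

/-- Symmetric second-order difference matrix `D²` with Neumann corners:
diagonal `(-1, -2, …, -2, -1)/h²`, off-diagonals `1/h²`. -/
def D2 (M : ℕ) (h : ℝ) : Matrix (Fin M) (Fin M) ℝ :=
  Matrix.of fun j k =>
    if k = j then (if (j : ℕ) = 0 ∨ (j : ℕ) = M - 1 then -1 / h ^ 2 else -2 / h ^ 2)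
    else if (k : ℕ) = (j : ℕ) + 1 ∨ (j : ℕ) = (k : ℕ) + 1 then 1 / h ^ 2
    else 0

/-- SBP weight matrix `Λ = diag(1/2, 1, …, 1, 1/2)`. -/
def Lam (M : ℕ) : Matrix (Fin M) (Fin M) ℝ :=
  Matrix.of fun j k =>
    if k = j then (if (j : ℕ) = 0 ∨ (j : ℕ) = M - 1 then 1 / 2 else 1) else 0

/-- Regular-grid second-order central difference matrix with ghost-point Neumann closure. -/
def Dbar2 (M : ℕ) (h : ℝ) : Matrix (Fin M) (Fin M) ℝ :=
  Matrix.of fun j k =>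
    if (j : ℕ) = 0 then
      if (k : ℕ) = 0 then -2 / h ^ 2 else if (k : ℕ) = 1 then 2 / h ^ 2 else 0
    else if (j : ℕ) = M - 1 then
      if (k : ℕ) = M - 1 then -2 / h ^ 2 else if (k : ℕ) = M - 2 then 2 / h ^ 2 else 0
    else
      if k = j then -2 / h ^ 2
      else if (k : ℕ) = (j : ℕ) + 1 ∨ (j : ℕ) = (k : ℕ) + 1 then 1 / h ^ 2 else 0

/-- Discrete `L²` inner product `(u,v)_h = h_x h_y ∑_{j,k} u_{jk} v_{jk}`. -/
def iph {m n : ℕ} (hx hy : ℝ) (u v : Matrix (Fin m) (Fin n) ℝ) : ℝ :=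
  hx * hy * ∑ j, ∑ k, u j k * v j k

/-- Entrywise `Φ · sin U`. -/
def hadSin {m n : ℕ} (Φ U : Matrix (Fin m) (Fin n) ℝ) : Matrix (Fin m) (Fin n) ℝ :=
  Matrix.of fun j k => Φ j k * Real.sin (U j k)

/-- Entrywise `Φ · (𝟙 - cos U)`. -/
def hadOneSubCos {m n : ℕ} (Φ U : Matrix (Fin m) (Fin n) ℝ) : Matrix (Fin m) (Fin n) ℝ :=
  Matrix.of fun j k => Φ j k * (1 - Real.cos (U j k))

/-- The all-ones matrix `𝟙`. -/
def oneM (m n : ℕ) : Matrix (Fin m) (Fin n) ℝ := Matrix.of fun _ _ => 1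

lemma HasDerivAt.matrix_mul_left_apply {l m n : ℕ} (P : Matrix (Fin l) (Fin m) ℝ)
    {A A' : ℝ → Matrix (Fin m) (Fin n) ℝ}
    (hA : ∀ t j k, HasDerivAt (fun s => A s j k) (A' t j k) t) (t : ℝ) (j : Fin l) (k : Fin n) :
    HasDerivAt (fun s => (P * A s) j k) ((P * A' t) j k) t := by
  simp only [Matrix.mul_apply]
  exact HasDerivAt.fun_sum fun i _ => (hA t i k).const_mul (P j i)

lemma HasDerivAt.matrix_mul_right_apply {l m n : ℕ} (P : Matrix (Fin m) (Fin n) ℝ)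
    {A A' : ℝ → Matrix (Fin l) (Fin m) ℝ}
    (hA : ∀ t j k, HasDerivAt (fun s => A s j k) (A' t j k) t) (t : ℝ) (j : Fin l) (k : Fin n) :
    HasDerivAt (fun s => (A s * P) j k) ((A' t * P) j k) t := by
  simp only [Matrix.mul_apply]
  exact HasDerivAt.fun_sum fun i _ => (hA t j i).mul_const (P i k)

lemma HasDerivAt.iph {m n : ℕ} (hx hy : ℝ) {A A' B B' : ℝ → Matrix (Fin m) (Fin n) ℝ}
    (hA : ∀ t j k, HasDerivAt (fun s => A s j k) (A' t j k) t)
    (hB : ∀ t j k, HasDerivAt (fun s => B s j k) (B' t j k) t) (t : ℝ) :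
    HasDerivAt (fun s => iph hx hy (A s) (B s))
      (iph hx hy (A' t) (B t) + iph hx hy (A t) (B' t)) t := by
  unfold _root_.iph
  rw [← mul_add, ← Finset.sum_add_distrib]
  simp only [← Finset.sum_add_distrib]
  exact (HasDerivAt.fun_sum fun j _ => HasDerivAt.fun_sum fun k _ =>
    (hA t j k).mul (hB t j k)).const_mul (hx * hy)

lemma iph_eq_trace {m n : ℕ} (hx hy : ℝ) (u v : Matrix (Fin m) (Fin n) ℝ) :
    iph hx hy u v = hx * hy * (u * vᵀ).trace := by
  simp [iph, Matrix.trace, Matrix.mul_apply]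

lemma iph_comm {m n : ℕ} (hx hy : ℝ) (u v : Matrix (Fin m) (Fin n) ℝ) :
    iph hx hy u v = iph hx hy v u := by
  simp only [iph, mul_comm]

lemma iph_add_right {m n : ℕ} (hx hy : ℝ) (u v w : Matrix (Fin m) (Fin n) ℝ) :
    iph hx hy u (v + w) = iph hx hy u v + iph hx hy u w := by
  simp only [iph_eq_trace, Matrix.transpose_add, Matrix.mul_add, Matrix.trace_add, mul_add]

lemma iph_sub_right {m n : ℕ} (hx hy : ℝ) (u v w : Matrix (Fin m) (Fin n) ℝ) :
    iph hx hy u (v - w) = iph hx hy u v - iph hx hy u w := by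
  simp only [iph_eq_trace, Matrix.transpose_sub, Matrix.mul_sub, Matrix.trace_sub, mul_sub]

lemma iph_neg_right {m n : ℕ} (hx hy : ℝ) (u v : Matrix (Fin m) (Fin n) ℝ) :
    iph hx hy u (-v) = -iph hx hy u v := by
  simp only [iph_eq_trace, Matrix.transpose_neg, Matrix.mul_neg, Matrix.trace_neg, mul_neg]

lemma iph_smul_right {m n : ℕ} (hx hy c : ℝ) (u v : Matrix (Fin m) (Fin n) ℝ) :
    iph hx hy u (c • v) = c * iph hx hy u v := by
  simp only [iph_eq_trace, Matrix.transpose_smul, Matrix.mul_smul, Matrix.trace_smul, smul_eq_mul]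
  ring

lemma iph_mul_left {l m n : ℕ} (hx hy : ℝ) (P : Matrix (Fin l) (Fin m) ℝ)
    (u : Matrix (Fin m) (Fin n) ℝ) (v : Matrix (Fin l) (Fin n) ℝ) :
    iph hx hy (P * u) v = iph hx hy u (Pᵀ * v) := by
  simp only [iph_eq_trace, Matrix.transpose_mul, Matrix.transpose_transpose]
  rw [Matrix.mul_assoc, Matrix.trace_mul_comm, Matrix.mul_assoc]

lemma iph_mul_right {l m n : ℕ} (hx hy : ℝ) (P : Matrix (Fin m) (Fin n) ℝ)
    (u : Matrix (Fin l) (Fin m) ℝ) (v : Matrix (Fin l) (Fin n) ℝ) :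
    iph hx hy (u * P) v = iph hx hy u (v * Pᵀ) := by
  simp only [iph_eq_trace, Matrix.transpose_mul, Matrix.transpose_transpose, Matrix.mul_assoc]

lemma Lam_eq_diagonal (M : ℕ) :
    Lam M = Matrix.diagonal fun j : Fin M => if (j : ℕ) = 0 ∨ (j : ℕ) = M - 1 then 1 / 2 else 1 := by
  ext j k
  simp only [Lam, Matrix.of_apply, Matrix.diagonal_apply, eq_comm]

lemma Lam_transpose (M : ℕ) : (Lam M)ᵀ = Lam M := by
  rw [Lam_eq_diagonal, Matrix.diagonal_transpose]

lemma isUnit_det_Lam (M : ℕ) : IsUnit (Lam M).det := by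
  rw [Lam_eq_diagonal, Matrix.det_diagonal, isUnit_iff_ne_zero, Finset.prod_ne_zero_iff]
  intro j _
  split_ifs <;> norm_num

lemma Dplus_castSucc_apply {N : ℕ} (h : ℝ) (i : Fin N) (k : Fin (N + 1)) :
    Dplus (N + 1) h i.castSucc k =
      ((if (k : ℕ) = i + 1 then 1 else 0) - (if (k : ℕ) = i then 1 else 0)) / h := by
  have hi : (i : ℕ) + 1 < N + 1 := by omega
  simp only [Dplus, Matrix.of_apply, Fin.val_castSucc, if_pos hi, Fin.ext_iff]
  split_ifs with h₁ h₂ <;> first | omega | ring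

/-- Summation by parts for the undivided Neumann Laplacian. -/
lemma Dplus_transpose_mul_Dplus {N : ℕ} (hN : 0 < N) (h : ℝ) :
    (Dplus (N + 1) h)ᵀ * Dplus (N + 1) h = -D2 (N + 1) h := by
  ext j k
  rw [Matrix.mul_apply, Fin.sum_univ_castSucc]
  have hlast : Dplus (N + 1) h (Fin.last N) k = 0 := by simp [Dplus]
  rw [hlast, mul_zero, add_zero]
  simp only [Matrix.transpose_apply, Dplus_castSucc_apply]
  rw [Fin.sum_univ_eq_sum_range (fun i : ℕ =>
    (((if (j : ℕ) = i + 1 then 1 else 0) - (if (j : ℕ) = i then 1 else 0)) / h *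
      (((if (k : ℕ) = i + 1 then 1 else 0) - (if (k : ℕ) = i then 1 else 0)) / h) : ℝ))]
  have hj := j.isLt
  have hk := k.isLt
  simp only [div_mul_div_comm, ← Finset.sum_div, sub_mul, Finset.sum_sub_distrib, ite_mul, one_mul,
    zero_mul, D2, Matrix.neg_apply, Matrix.of_apply, Fin.ext_iff]
  generalize (j : ℕ) = a at *
  generalize (k : ℕ) = c at *
  rw [Finset.sum_ite_eq]
  cases a with
  | zero =>
    simp only [Finset.mem_range, (Nat.succ_ne_zero _).symm, if_false, Finset.sum_const_zero,
      true_or, or_false, if_true]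
    split_ifs <;> first | omega | ring
  | succ m =>
    simp only [Nat.add_right_cancel_iff, Finset.sum_ite_eq, Finset.mem_range, Nat.succ_ne_zero,
      false_or]
    split_ifs <;> first | omega | ring

/-- The SAV reformulation of the SBP semi-discretization conserves the modified weighted energy. -/
theorem stmt15 (Nx Ny : ℕ) (hNx : 0 < Nx) (hNy : 0 < Ny)
    (hx hy : ℝ) (hhx : 0 < hx) (hhy : 0 < hy)
    (Φ : Matrix (Fin (Nx + 1)) (Fin (Ny + 1)) ℝ) (hΦ : ∀ j k, 0 < Φ j k)
    (U V U' V' : ℝ → Matrix (Fin (Nx + 1)) (Fin (Ny + 1)) ℝ) (R R' : ℝ → ℝ)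
    (hU : ∀ t j k, HasDerivAt (fun s => U s j k) (U' t j k) t)
    (hV : ∀ t j k, HasDerivAt (fun s => V s j k) (V' t j k) t)
    (hR : ∀ t, HasDerivAt R (R' t) t)
    (hH1 : ∀ t, 0 < iph hx hy (Lam (Nx + 1) * hadOneSubCos Φ (U t) * Lam (Ny + 1))
        (oneM (Nx + 1) (Ny + 1)))
    (b : ℝ → Matrix (Fin (Nx + 1)) (Fin (Ny + 1)) ℝ)
    (hb : ∀ t, b t =
      (Real.sqrt (iph hx hy (Lam (Nx + 1) * hadOneSubCos Φ (U t) * Lam (Ny + 1))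
        (oneM (Nx + 1) (Ny + 1))))⁻¹ • hadSin Φ (U t))
    (heq1 : ∀ t, U' t = V t)
    (heq2 : ∀ t, V' t =
      (Lam (Nx + 1))⁻¹ * D2 (Nx + 1) hx * U t + U t * D2 (Ny + 1) hy * (Lam (Ny + 1))⁻¹ -
        R t • b t)
    (heq3 : ∀ t, R' t = (1 / 2) * iph hx hy (Lam (Nx + 1) * b t * Lam (Ny + 1)) (U' t)) :
    ∀ t₁ t₂ : ℝ,
      (1 / 2) * iph hx hy (Lam (Nx + 1) * V t₁ * Lam (Ny + 1)) (V t₁) +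
        (1 / 2) * (iph hx hy (Dplus (Nx + 1) hx * U t₁ * Lam (Ny + 1)) (Dplus (Nx + 1) hx * U t₁) +
          iph hx hy (Lam (Nx + 1) * (U t₁ * (Dplus (Ny + 1) hy)ᵀ)) (U t₁ * (Dplus (Ny + 1) hy)ᵀ)) +
        R t₁ ^ 2 =
      (1 / 2) * iph hx hy (Lam (Nx + 1) * V t₂ * Lam (Ny + 1)) (V t₂) +
        (1 / 2) * (iph hx hy (Dplus (Nx + 1) hx * U t₂ * Lam (Ny + 1)) (Dplus (Nx + 1) hx * U t₂) +
          iph hx hy (Lam (Nx + 1) * (U t₂ * (Dplus (Ny + 1) hy)ᵀ)) (U t₂ * (Dplus (Ny + 1) hy)ᵀ)) +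
        R t₂ ^ 2 := by
  have hΛx := isUnit_det_Lam (Nx + 1)
  have hΛy := isUnit_det_Lam (Ny + 1)
  have hΛVΛ := HasDerivAt.matrix_mul_right_apply (Lam (Ny + 1))
    (HasDerivAt.matrix_mul_left_apply (Lam (Nx + 1)) hV)
  have hDx := HasDerivAt.matrix_mul_left_apply (Dplus (Nx + 1) hx) hU
  have hDxΛ := HasDerivAt.matrix_mul_right_apply (Lam (Ny + 1)) hDx
  have hDy := HasDerivAt.matrix_mul_right_apply (Dplus (Ny + 1) hy)ᵀ hU
  have hΛDy := HasDerivAt.matrix_mul_left_apply (Lam (Nx + 1)) hDy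
  have hE := fun t => ((((HasDerivAt.iph hx hy hΛVΛ hV t).const_mul (1 / 2)).add
    (((HasDerivAt.iph hx hy hDxΛ hDx t).add
      (HasDerivAt.iph hx hy hΛDy hDy t)).const_mul (1 / 2))).add ((hR t).pow 2))
  refine is_const_of_deriv_eq_zero (fun t => (hE t).differentiableAt) fun t => ?_
  refine (hE t).deriv.trans ?_
  rw [heq3 t, heq1 t]
  have h1 : iph hx hy (Lam (Nx + 1) * V' t * Lam (Ny + 1)) (V t) =
      iph hx hy (Lam (Nx + 1) * V t * Lam (Ny + 1)) (V' t) := by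
    rw [iph_mul_right, iph_mul_left, iph_comm, Lam_transpose, Lam_transpose, Matrix.mul_assoc]
  have h2 : iph hx hy (Dplus (Nx + 1) hx * V t * Lam (Ny + 1)) (Dplus (Nx + 1) hx * U t) =
      iph hx hy (Dplus (Nx + 1) hx * U t * Lam (Ny + 1)) (Dplus (Nx + 1) hx * V t) := by
    rw [iph_mul_right, iph_comm, Lam_transpose]
  have h3 : iph hx hy (Lam (Nx + 1) * (V t * (Dplus (Ny + 1) hy)ᵀ)) (U t * (Dplus (Ny + 1) hy)ᵀ) =
      iph hx hy (Lam (Nx + 1) * (U t * (Dplus (Ny + 1) hy)ᵀ)) (V t * (Dplus (Ny + 1) hy)ᵀ) := by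
    rw [iph_mul_left, iph_comm, Lam_transpose]
  have h4 : iph hx hy (Dplus (Nx + 1) hx * U t * Lam (Ny + 1)) (Dplus (Nx + 1) hx * V t) =
      -iph hx hy (Lam (Nx + 1) * V t * Lam (Ny + 1))
        ((Lam (Nx + 1))⁻¹ * D2 (Nx + 1) hx * U t) := by
    rw [← h2, iph_mul_right, Matrix.mul_assoc, iph_mul_left, iph_mul_right, iph_mul_left,
      Lam_transpose, Lam_transpose, Matrix.mul_assoc, Matrix.mul_assoc,
      Matrix.mul_nonsing_inv_cancel_left _ _ hΛx, ← iph_neg_right, ← Matrix.neg_mul,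
      ← Dplus_transpose_mul_Dplus hNx]
    simp only [Matrix.mul_assoc]
  have h5 : iph hx hy (Lam (Nx + 1) * (U t * (Dplus (Ny + 1) hy)ᵀ)) (V t * (Dplus (Ny + 1) hy)ᵀ) =
      -iph hx hy (Lam (Nx + 1) * V t * Lam (Ny + 1))
        (U t * D2 (Ny + 1) hy * (Lam (Ny + 1))⁻¹) := by
    rw [← h3, iph_mul_left, iph_mul_right, iph_mul_right, iph_mul_left,
      Lam_transpose, Lam_transpose, Matrix.nonsing_inv_mul_cancel_right _ _ hΛy,
      ← iph_neg_right, ← Matrix.mul_neg, ← Matrix.mul_neg,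
      ← Dplus_transpose_mul_Dplus hNy]
    simp only [Matrix.transpose_transpose, Matrix.mul_assoc]
  have h6 : iph hx hy (Lam (Nx + 1) * b t * Lam (Ny + 1)) (V t) =
      iph hx hy (Lam (Nx + 1) * V t * Lam (Ny + 1)) (b t) := by
    rw [iph_mul_right, iph_mul_left, iph_comm, Lam_transpose, Lam_transpose, Matrix.mul_assoc]
  rw [h1, h2, h3, h4, h5, h6, heq2 t, iph_sub_right, iph_add_right, iph_smul_right]
  ring

end
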